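/- arXiv:1104.2080 — 2 statements merged into one kernel-verified Lean document; each statement's English description precedes it below -/
import Mathlib

section
/- For every N ≥ 1, every n ∈ (0,1], every q ∈ [0,1], every β > 0 and h ∈ ℝ: φ_N(n,β,h) ≤ log 2 + (1/n) log ∫_ℝ cosh^n(β(√q z + h)) dμ(z) + (β²/4)(1 − 2q − (n−1)q²). -/
open MeasureTheory ProbabilityTheory Real Filter Topology

noncomputable section

/-- The ±1 spin value attached to a Boolean. -/
def spinVal (b : Bool) : ℝ := if b then 1 else -1

/-- Law of the couplings `J = (J_{ij})`: i.i.d. standard Gaussians. -/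
def skMuJ (N : ℕ) : Measure (Fin N × Fin N → ℝ) :=
  Measure.pi fun _ => gaussianReal 0 1

/-- The Sherrington–Kirkpatrick Hamiltonian. -/
def skH (N : ℕ) (h : ℝ) (J : Fin N × Fin N → ℝ) (σ : Fin N → Bool) : ℝ :=
  -(1 / Real.sqrt (N : ℝ)) *
      ∑ p ∈ Finset.univ.filter (fun p : Fin N × Fin N => p.1 < p.2),
        J p * spinVal (σ p.1) * spinVal (σ p.2)
    - h * ∑ i, spinVal (σ i)

/-- The SK partition function. -/
def skZ (N : ℕ) (β h : ℝ) (J : Fin N × Fin N → ℝ) : ℝ :=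
  ∑ σ : Fin N → Bool, Real.exp (-β * skH N h J σ)

/-- Quenched pressure `α_N(β,h) = N⁻¹ E log Z_N`. -/
def skAlpha (N : ℕ) (β h : ℝ) : ℝ :=
  (1 / (N : ℝ)) * ∫ J, Real.log (skZ N β h J) ∂ skMuJ N

/-- Interpolating function `φ_N(n,β,h) = (Nn)⁻¹ log E[Z_N^n]`. -/
def skPhi (N : ℕ) (n β h : ℝ) : ℝ :=
  (1 / ((N : ℝ) * n)) * Real.log (∫ J, skZ N β h J ^ n ∂ skMuJ N)

/-- Gaussian integration by parts in one dimension. -/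
lemma integral_id_mul_gaussianReal {f f' : ℝ → ℝ} (hf : ∀ x, HasDerivAt f (f' x) x)
    (h : Integrable f (gaussianReal 0 1)) (h' : Integrable f' (gaussianReal 0 1))
    (hx : Integrable (fun x => x * f x) (gaussianReal 0 1)) :
    ∫ x, x * f x ∂gaussianReal 0 1 = ∫ x, f' x ∂gaussianReal 0 1 := by
  have key : ∀ g : ℝ → ℝ, Integrable g (gaussianReal 0 1) →
      Integrable (fun x => gaussianPDFReal 0 1 x * g x) volume := by
    intro g hg
    rw [gaussianReal_of_var_ne_zero 0 one_ne_zero,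
      integrable_withDensity_iff_integrable_smul' (measurable_gaussianPDF _ _)
        (ae_of_all _ fun _ => gaussianPDF_lt_top)] at hg
    simpa using hg
  have hpdf : ∀ x, HasDerivAt (gaussianPDFReal 0 1) (-x * gaussianPDFReal 0 1 x) x := by
    intro x
    rw [gaussianPDFReal_def]
    have h1 : HasDerivAt (fun x : ℝ => -(x - 0) ^ 2 / (2 * ((1 : NNReal) : ℝ))) (-x) x := by
      have := (((hasDerivAt_id x).sub_const 0).pow 2).neg.div_const (2 * ((1 : NNReal) : ℝ))
      convert! this using 1
      simp only [id_eq, sub_zero, pow_one, Nat.add_one_sub_one, NNReal.coe_one, Nat.cast_ofNat]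
      ring
    convert! (h1.exp).const_mul _ using 1
    ring
  rw [integral_gaussianReal_eq_integral_smul one_ne_zero,
    integral_gaussianReal_eq_integral_smul one_ne_zero]
  simp only [smul_eq_mul]
  rw [integral_mul_deriv_eq_deriv_mul_of_integrable (u' := fun x => -x * gaussianPDFReal 0 1 x)
    (v := f) (fun x _ => hpdf x) (fun x _ => hf x) (key _ h') ?_ (key _ h), ← integral_neg]
  · congr 1
    ext x
    ring
  · refine (key _ hx).neg.congr (ae_of_all _ fun x => ?_)
    simp only [Pi.neg_apply, Pi.mul_apply]
    ring

/-- Resampling one coordinate preserves a product probability measure. -/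
lemma measurePreserving_update_pi {κ : Type*} [Fintype κ] [DecidableEq κ] (ν : Measure ℝ)
    [IsProbabilityMeasure ν] (k : κ) :
    MeasurePreserving (fun p : (κ → ℝ) × ℝ => Function.update p.1 k p.2)
      ((Measure.pi fun _ : κ => ν).prod ν) (Measure.pi fun _ : κ => ν) := by
  have hm : Measurable (fun p : (κ → ℝ) × ℝ => Function.update p.1 k p.2) := by
    refine measurable_pi_iff.2 fun j => ?_
    by_cases hj : j = k
    · subst hj
      simpa using measurable_snd
    · simp only [Function.update_of_ne hj]
      fun_prop
  refine ⟨hm, (Measure.pi_eq fun s hs => ?_).symm⟩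
  rw [Measure.map_apply hm (MeasurableSet.univ_pi hs)]
  have hset : (fun p : (κ → ℝ) × ℝ => Function.update p.1 k p.2) ⁻¹' (Set.univ.pi s)
      = (Set.univ.pi (Function.update s k Set.univ)) ×ˢ (s k) := by
    ext ⟨g, y⟩
    simp only [Set.mem_preimage, Set.mem_univ_pi, Set.mem_prod]
    constructor
    · intro h
      refine ⟨fun i => ?_, by simpa using h k⟩
      by_cases hi : i = k
      · subst hi
        simp
      · simpa [Function.update_of_ne hi] using h i
    · rintro ⟨h1, h2⟩ i
      by_cases hi : i = k
      · subst hi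
        simpa using h2
      · simpa [Function.update_of_ne hi] using h1 i
  rw [hset, Measure.prod_prod, Measure.pi_pi, ← Finset.prod_erase_mul _ _ (Finset.mem_univ k),
    ← Finset.prod_erase_mul Finset.univ (fun i => ν (s i)) (Finset.mem_univ k)]
  simp only [Function.update_self, measure_univ, mul_one]
  congr 1
  refine Finset.prod_congr rfl fun i hi => ?_
  rw [Function.update_of_ne (Finset.ne_of_mem_erase hi)]

/-- Gaussian integration by parts for a standard Gaussian vector. -/
lemma integral_coord_mul_pi_gaussianReal {κ : Type*} [Fintype κ] [DecidableEq κ] (k : κ)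
    {f f' : (κ → ℝ) → ℝ}
    (hf : ∀ g y, HasDerivAt (fun y => f (Function.update g k y)) (f' (Function.update g k y)) y)
    (h : Integrable f (Measure.pi fun _ : κ => gaussianReal 0 1))
    (h' : Integrable f' (Measure.pi fun _ : κ => gaussianReal 0 1))
    (hx : Integrable (fun g => g k * f g) (Measure.pi fun _ : κ => gaussianReal 0 1)) :
    ∫ g, g k * f g ∂(Measure.pi fun _ : κ => gaussianReal 0 1) =
      ∫ g, f' g ∂(Measure.pi fun _ : κ => gaussianReal 0 1) := by
  have mp := measurePreserving_update_pi (κ := κ) (gaussianReal 0 1) k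
  have hI : ∀ {F : (κ → ℝ) → ℝ}, Integrable F (Measure.pi fun _ : κ => gaussianReal 0 1) →
      Integrable (fun p : (κ → ℝ) × ℝ => F (Function.update p.1 k p.2))
        ((Measure.pi fun _ : κ => gaussianReal 0 1).prod (gaussianReal 0 1)) :=
    fun hF => mp.integrable_comp_of_integrable hF
  have hE : ∀ {F : (κ → ℝ) → ℝ}, Integrable F (Measure.pi fun _ : κ => gaussianReal 0 1) →
      ∫ g, F g ∂(Measure.pi fun _ : κ => gaussianReal 0 1) =
        ∫ g, ∫ y, F (Function.update g k y) ∂gaussianReal 0 1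
          ∂(Measure.pi fun _ : κ => gaussianReal 0 1) := by
    intro F hF
    have hmap := integral_map (f := F) mp.measurable.aemeasurable
      (by rw [mp.map_eq]; exact hF.aestronglyMeasurable)
    rw [mp.map_eq] at hmap
    rw [hmap, integral_prod _ (hI hF)]
  rw [hE hx, hE h']
  refine integral_congr_ae ?_
  filter_upwards [(hI h).prod_right_ae, (hI h').prod_right_ae, (hI hx).prod_right_ae]
    with g h1 h2 h3
  simp only [Function.update_self] at h3 ⊢
  exact integral_id_mul_gaussianReal (hf g) h1 h2 h3

/-- Exponentials of the `ℓ¹` norm are integrable for a standard Gaussian vector. -/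
lemma integrable_exp_sum_abs_pi_gaussianReal {κ : Type*} [Fintype κ] (C : ℝ) :
    Integrable (fun g : κ → ℝ => Real.exp (C * ∑ k, |g k|))
      (Measure.pi fun _ : κ => gaussianReal 0 1) := by
  have h1 : Integrable (fun x : ℝ => Real.exp (C * |x|)) (gaussianReal 0 1) :=
    integrable_exp_mul_abs (X := fun x => x) (integrable_exp_mul_gaussianReal _)
      (integrable_exp_mul_gaussianReal _)
  simpa [Finset.mul_sum, Real.exp_sum] using
    Integrable.fintype_prod (f := fun (_ : κ) (x : ℝ) => Real.exp (C * |x|)) fun _ => h1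

section GaussianPartition

variable {S κ : Type*} [Fintype κ]

/-- The exponent `X_σ(g) = ∑ₖ u_{σk} gₖ + d_σ`. -/
def gaussExponent (u : S → κ → ℝ) (d : S → ℝ) (g : κ → ℝ) (σ : S) : ℝ :=
  ∑ k, u σ k * g k + d σ

lemma continuous_gaussExponent (u : S → κ → ℝ) (d : S → ℝ) (σ : S) :
    Continuous fun g => gaussExponent u d g σ := by
  unfold gaussExponent
  fun_prop

lemma abs_gaussExponent_le {u : S → κ → ℝ} {d : S → ℝ} {C D : ℝ} (hu : ∀ σ k, |u σ k| ≤ C)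
    (hd : ∀ σ, |d σ| ≤ D) (g : κ → ℝ) (σ : S) :
    |gaussExponent u d g σ| ≤ C * ∑ k, |g k| + D := by
  refine (abs_add_le _ _).trans (add_le_add ?_ (hd σ))
  rw [Finset.mul_sum]
  refine (Finset.abs_sum_le_sum_abs _ _).trans (Finset.sum_le_sum fun k _ => ?_)
  rw [abs_mul]
  exact mul_le_mul_of_nonneg_right (hu σ k) (abs_nonneg _)

variable [Fintype S]

/-- The partition function `∑_σ exp X_σ(g)`. -/
def gaussPartition (u : S → κ → ℝ) (d : S → ℝ) (g : κ → ℝ) : ℝ :=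
  ∑ σ, Real.exp (gaussExponent u d g σ)

/-- The tilted weight `Z^(n-1) exp X_σ`, whose sum over `σ` is `Z^n`. -/
def tiltedWeight (n : ℝ) (u : S → κ → ℝ) (d : S → ℝ) (g : κ → ℝ) (σ : S) : ℝ :=
  gaussPartition u d g ^ (n - 1) * Real.exp (gaussExponent u d g σ)

/-- The Gibbs average of the coefficient `u_{·k}`. -/
def gibbsMean (u : S → κ → ℝ) (d : S → ℝ) (g : κ → ℝ) (k : κ) : ℝ :=
  (gaussPartition u d g)⁻¹ * ∑ τ, u τ k * Real.exp (gaussExponent u d g τ)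

lemma gaussPartition_pos [Nonempty S] (u : S → κ → ℝ) (d : S → ℝ) (g : κ → ℝ) :
    0 < gaussPartition u d g :=
  Finset.sum_pos (fun _ _ => Real.exp_pos _) Finset.univ_nonempty

lemma continuous_gaussPartition (u : S → κ → ℝ) (d : S → ℝ) :
    Continuous (gaussPartition u d) := by
  unfold gaussPartition
  exact continuous_finsetSum _ fun σ _ => (continuous_gaussExponent u d σ).rexp

lemma continuous_tiltedWeight [Nonempty S] (n : ℝ) (u : S → κ → ℝ) (d : S → ℝ) (σ : S) :
    Continuous fun g => tiltedWeight n u d g σ := by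
  unfold tiltedWeight
  exact ((continuous_gaussPartition u d).rpow_const
    fun g => Or.inl (gaussPartition_pos u d g).ne').mul (continuous_gaussExponent u d σ).rexp

lemma continuous_gibbsMean [Nonempty S] (u : S → κ → ℝ) (d : S → ℝ) (k : κ) :
    Continuous fun g => gibbsMean u d g k := by
  unfold gibbsMean
  exact ((continuous_gaussPartition u d).inv₀ fun g => (gaussPartition_pos u d g).ne').mul
    (continuous_finsetSum _ fun τ _ => (continuous_gaussExponent u d τ).rexp.const_mul _)

lemma tiltedWeight_nonneg (n : ℝ) (u : S → κ → ℝ) (d : S → ℝ) (g : κ → ℝ) (σ : S) :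
    0 ≤ tiltedWeight n u d g σ :=
  mul_nonneg (Real.rpow_nonneg (Finset.sum_nonneg fun _ _ => (Real.exp_pos _).le) _)
    (Real.exp_pos _).le

lemma sum_tiltedWeight [Nonempty S] (n : ℝ) (u : S → κ → ℝ) (d : S → ℝ) (g : κ → ℝ) :
    ∑ σ, tiltedWeight n u d g σ = gaussPartition u d g ^ n := by
  have hZ := gaussPartition_pos u d g
  have h : ∑ σ, tiltedWeight n u d g σ = gaussPartition u d g ^ (n - 1) * gaussPartition u d g := by
    simp only [tiltedWeight, ← Finset.mul_sum]
    rfl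
  rw [h, Real.rpow_sub_one hZ.ne', div_mul_cancel₀ _ hZ.ne']

lemma tiltedWeight_le {n : ℝ} (hn : n ∈ Set.Ioc (0 : ℝ) 1) {u : S → κ → ℝ} {d : S → ℝ} {C D : ℝ}
    (hu : ∀ σ k, |u σ k| ≤ C) (hd : ∀ σ, |d σ| ≤ D) (g : κ → ℝ) (σ : S) :
    tiltedWeight n u d g σ ≤ Real.exp D * Real.exp (C * ∑ k, |g k|) := by
  have h1 : gaussPartition u d g ^ (n - 1) ≤ Real.exp (gaussExponent u d g σ) ^ (n - 1) := by
    refine Real.rpow_le_rpow_of_nonpos (Real.exp_pos _) ?_ (by linarith [hn.2])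
    exact Finset.single_le_sum (f := fun σ => Real.exp (gaussExponent u d g σ))
      (fun _ _ => (Real.exp_pos _).le) (Finset.mem_univ σ)
  refine (mul_le_mul_of_nonneg_right h1 (Real.exp_pos _).le).trans ?_
  rw [← Real.exp_mul, ← Real.exp_add, ← Real.exp_add, Real.exp_le_exp]
  have h2 := abs_gaussExponent_le hu hd g σ
  have h3 : n * gaussExponent u d g σ ≤ 1 * |gaussExponent u d g σ| :=
    (mul_le_mul_of_nonneg_left (le_abs_self _) hn.1.le).trans
      (mul_le_mul_of_nonneg_right hn.2 (abs_nonneg _))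
  linarith

lemma abs_gibbsMean_le [Nonempty S] {u : S → κ → ℝ} {C : ℝ} (hu : ∀ σ k, |u σ k| ≤ C) (d : S → ℝ)
    (g : κ → ℝ) (k : κ) : |gibbsMean u d g k| ≤ C := by
  have hZ := gaussPartition_pos u d g
  rw [gibbsMean, abs_mul, abs_of_pos (inv_pos.2 hZ), inv_mul_le_iff₀ hZ, gaussPartition,
    Finset.sum_mul]
  refine (Finset.abs_sum_le_sum_abs _ _).trans (Finset.sum_le_sum fun τ _ => ?_)
  rw [abs_mul, abs_of_pos (Real.exp_pos _), mul_comm]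
  exact mul_le_mul_of_nonneg_left (hu τ k) (Real.exp_pos _).le

lemma exists_abs_le (u : S → κ → ℝ) (d : S → ℝ) :
    ∃ C, 0 ≤ C ∧ (∀ σ k, |u σ k| ≤ C) ∧ ∀ σ, |d σ| ≤ C := by
  refine ⟨∑ σ, (∑ k, |u σ k| + |d σ|), Finset.sum_nonneg fun σ _ => by positivity,
    fun σ k => ?_, fun σ => ?_⟩
  · have h1 := Finset.single_le_sum (f := fun σ => ∑ k, |u σ k| + |d σ|)
      (fun _ _ => by positivity) (Finset.mem_univ σ)
    have h2 := Finset.single_le_sum (f := fun k => |u σ k|)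
      (fun _ _ => by positivity) (Finset.mem_univ k)
    linarith [abs_nonneg (d σ)]
  · have h1 := Finset.single_le_sum (f := fun σ => ∑ k, |u σ k| + |d σ|)
      (fun _ _ => by positivity) (Finset.mem_univ σ)
    have h2 : 0 ≤ ∑ k, |u σ k| := by positivity
    linarith

/-- Continuous functions of at most exponential growth are integrable for a standard Gaussian
vector. -/
lemma integrable_pi_gaussianReal_of_le {F : (κ → ℝ) → ℝ} (hF : Continuous F) {A C : ℝ}
    (h : ∀ g, |F g| ≤ A * Real.exp (C * ∑ k, |g k|)) :
    Integrable F (Measure.pi fun _ : κ => gaussianReal 0 1) :=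
  ((integrable_exp_sum_abs_pi_gaussianReal C).const_mul A).mono' hF.aestronglyMeasurable
    (ae_of_all _ h)

lemma sum_abs_le_exp (g : κ → ℝ) : ∑ k, |g k| ≤ Real.exp (∑ k, |g k|) := by
  linarith [Real.add_one_le_exp (∑ k, |g k|)]

lemma integrable_tiltedWeight [Nonempty S] {n : ℝ} (hn : n ∈ Set.Ioc (0 : ℝ) 1) (u : S → κ → ℝ)
    (d : S → ℝ) (σ : S) :
    Integrable (fun g => tiltedWeight n u d g σ) (Measure.pi fun _ : κ => gaussianReal 0 1) := by
  obtain ⟨C, -, hu, hd⟩ := exists_abs_le u d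
  refine integrable_pi_gaussianReal_of_le (A := Real.exp C) (C := C)
    (continuous_tiltedWeight n u d σ) fun g => ?_
  rw [abs_of_nonneg (tiltedWeight_nonneg n u d g σ)]
  exact tiltedWeight_le hn hu hd g σ

lemma integrable_coord_mul_tiltedWeight [Nonempty S] {n : ℝ} (hn : n ∈ Set.Ioc (0 : ℝ) 1)
    (u : S → κ → ℝ) (d : S → ℝ) (σ : S) (k : κ) :
    Integrable (fun g => g k * tiltedWeight n u d g σ)
      (Measure.pi fun _ : κ => gaussianReal 0 1) := by
  obtain ⟨C, -, hu, hd⟩ := exists_abs_le u d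
  refine integrable_pi_gaussianReal_of_le (A := Real.exp C) (C := C + 1)
    ((continuous_apply k).mul (continuous_tiltedWeight n u d σ)) fun g => ?_
  rw [abs_mul, abs_of_nonneg (tiltedWeight_nonneg n u d g σ), add_mul, one_mul, Real.exp_add,
    ← mul_assoc, mul_comm]
  refine mul_le_mul (tiltedWeight_le hn hu hd g σ) ?_ (abs_nonneg _) (by positivity)
  exact (Finset.single_le_sum (f := fun k => |g k|) (fun _ _ => abs_nonneg _)
    (Finset.mem_univ k)).trans (sum_abs_le_exp g)

lemma integrable_tiltedWeight_mul_gibbsMean [Nonempty S] {n : ℝ} (hn : n ∈ Set.Ioc (0 : ℝ) 1)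
    (u : S → κ → ℝ) (d : S → ℝ) (σ : S) (k : κ) :
    Integrable (fun g => tiltedWeight n u d g σ * gibbsMean u d g k)
      (Measure.pi fun _ : κ => gaussianReal 0 1) := by
  obtain ⟨C, hC, hu, hd⟩ := exists_abs_le u d
  refine integrable_pi_gaussianReal_of_le (A := C * Real.exp C) (C := C)
    ((continuous_tiltedWeight n u d σ).mul (continuous_gibbsMean u d k)) fun g => ?_
  rw [abs_mul, abs_of_nonneg (tiltedWeight_nonneg n u d g σ), mul_comm, mul_assoc]
  exact mul_le_mul (abs_gibbsMean_le hu d g k) (tiltedWeight_le hn hu hd g σ)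
    (tiltedWeight_nonneg n u d g σ) hC

/-- Integration by parts for the tilted weights. -/
lemma integral_coord_mul_tiltedWeight [Nonempty S] {n : ℝ} (hn : n ∈ Set.Ioc (0 : ℝ) 1)
    (u : S → κ → ℝ) (d : S → ℝ) (σ : S) (k : κ) :
    ∫ g, g k * tiltedWeight n u d g σ ∂(Measure.pi fun _ : κ => gaussianReal 0 1) =
      ∫ g, tiltedWeight n u d g σ * (u σ k + (n - 1) * gibbsMean u d g k)
        ∂(Measure.pi fun _ : κ => gaussianReal 0 1) := by
  classical
  refine integral_coord_mul_pi_gaussianReal k (fun g y => ?_) (integrable_tiltedWeight hn u d σ) ?_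
    (integrable_coord_mul_tiltedWeight hn u d σ k)
  · have hX : ∀ τ, HasDerivAt (fun y => gaussExponent u d (Function.update g k y) τ) (u τ k) y := by
      intro τ
      have h1 := hasDerivAt_pi.1 (hasDerivAt_update g k y)
      have h2 := (HasDerivAt.fun_sum fun j (_ : j ∈ Finset.univ) =>
        (h1 j).const_mul (u τ j)).add_const (d τ)
      convert! h2 using 1
      simp [Pi.single_apply]
    have hZ : HasDerivAt (fun y => gaussPartition u d (Function.update g k y))
        (∑ τ, u τ k * Real.exp (gaussExponent u d (Function.update g k y) τ)) y := by
      unfold gaussPartition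
      convert! HasDerivAt.fun_sum fun τ (_ : τ ∈ Finset.univ) => (hX τ).exp using 1
      exact Finset.sum_congr rfl fun τ _ => mul_comm _ _
    have hpos := gaussPartition_pos u d (Function.update g k y)
    have h3 := (hZ.rpow_const (p := n - 1) (Or.inl hpos.ne')).mul (hX σ).exp
    convert! h3 using 1
    rw [Real.rpow_sub_one hpos.ne', tiltedWeight, gibbsMean]
    field_simp
    ring
  · simp only [mul_add]
    refine ((integrable_tiltedWeight hn u d σ).mul_const _).add ?_
    simpa only [mul_left_comm] using
      (integrable_tiltedWeight_mul_gibbsMean hn u d σ k).const_mul (n - 1)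

/-- Derivative of `E[Z^n]` along a path of Gaussian exponents, after integration by parts. -/
lemma hasDerivAt_integral_gaussPartition_rpow [Nonempty S] {n : ℝ} (hn : n ∈ Set.Ioc (0 : ℝ) 1)
    {u u' : ℝ → S → κ → ℝ} {d d' : ℝ → S → ℝ} {C D : ℝ}
    (hu : ∀ t σ k, HasDerivAt (fun t => u t σ k) (u' t σ k) t)
    (hd : ∀ t σ, HasDerivAt (fun t => d t σ) (d' t σ) t)
    (hC : ∀ t σ k, |u t σ k| ≤ C) (hC' : ∀ t σ k, |u' t σ k| ≤ C)
    (hD : ∀ t σ, |d t σ| ≤ D) (hD' : ∀ t σ, |d' t σ| ≤ D) (t : ℝ) :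
    HasDerivAt
      (fun t => ∫ g, gaussPartition (u t) (d t) g ^ n ∂(Measure.pi fun _ : κ => gaussianReal 0 1))
      (n * ∫ g, ∑ σ, tiltedWeight n (u t) (d t) g σ *
        (∑ k, u' t σ k * (u t σ k + (n - 1) * gibbsMean (u t) (d t) g k) + d' t σ)
          ∂(Measure.pi fun _ : κ => gaussianReal 0 1)) t := by
  set γ := Measure.pi fun _ : κ => gaussianReal 0 1 with hγ
  have hX : ∀ s g σ, HasDerivAt (fun t => gaussExponent (u t) (d t) g σ)
      (gaussExponent (u' s) (d' s) g σ) s := fun s g σ =>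
    (HasDerivAt.fun_sum fun k (_ : k ∈ Finset.univ) => (hu s σ k).mul_const (g k)).add (hd s σ)
  have hZ : ∀ s g, HasDerivAt (fun t => gaussPartition (u t) (d t) g)
      (∑ σ, Real.exp (gaussExponent (u s) (d s) g σ) * gaussExponent (u' s) (d' s) g σ) s :=
    fun s g => HasDerivAt.fun_sum fun σ (_ : σ ∈ Finset.univ) => (hX s g σ).exp
  have hZn : ∀ s g, HasDerivAt (fun t => gaussPartition (u t) (d t) g ^ n)
      (n * ∑ σ, tiltedWeight n (u s) (d s) g σ * gaussExponent (u' s) (d' s) g σ) s := by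
    intro s g
    convert! (hZ s g).rpow_const (p := n)
      (Or.inl (gaussPartition_pos (u s) (d s) g).ne') using 1
    simp only [tiltedWeight, Finset.mul_sum, Finset.sum_mul]
    exact Finset.sum_congr rfl fun σ _ => by ring
  have hcont : ∀ s, Continuous fun g => gaussPartition (u s) (d s) g ^ n := fun s =>
    (continuous_gaussPartition (u s) (d s)).rpow_const
      fun g => Or.inl (gaussPartition_pos (u s) (d s) g).ne'
  have hD0 : ∀ σ : S, 0 ≤ D := fun σ => (abs_nonneg _).trans (hD t σ)
  have hbound : ∀ s g, ‖n * ∑ σ, tiltedWeight n (u s) (d s) g σ * gaussExponent (u' s) (d' s) g σ‖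
      ≤ ∑ _σ : S, (Real.exp D * (|C| + D)) * Real.exp ((C + 1) * ∑ k, |g k|) := by
    intro s g
    rw [Real.norm_eq_abs, abs_mul, abs_of_pos hn.1]
    refine (mul_le_of_le_one_left (abs_nonneg _) hn.2).trans
      ((Finset.abs_sum_le_sum_abs _ _).trans (Finset.sum_le_sum fun σ _ => ?_))
    rw [abs_mul, abs_of_nonneg (tiltedWeight_nonneg _ _ _ _ _)]
    have h1 := tiltedWeight_le hn (hC s) (hD s) g σ
    have h0 : 0 ≤ ∑ k, |g k| := Finset.sum_nonneg fun _ _ => abs_nonneg _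
    have h2 : |gaussExponent (u' s) (d' s) g σ| ≤ (|C| + D) * Real.exp (∑ k, |g k|) := by
      refine (abs_gaussExponent_le (hC' s) (hD' s) g σ).trans ?_
      rw [add_mul]
      refine add_le_add ?_ ?_
      · exact (mul_le_mul_of_nonneg_right (le_abs_self C) h0).trans
          (mul_le_mul_of_nonneg_left (sum_abs_le_exp g) (abs_nonneg _))
      · exact le_mul_of_one_le_right (hD0 σ) (Real.one_le_exp h0)
    refine (mul_le_mul h1 h2 (abs_nonneg _) (by positivity)).trans_eq ?_
    rw [add_mul C, one_mul, Real.exp_add]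
    ring
  have hmain := (hasDerivAt_integral_of_dominated_loc_of_deriv_le (μ := γ) (x₀ := t)
    (F := fun t g => gaussPartition (u t) (d t) g ^ n)
    (bound := fun g => ∑ _σ : S, (Real.exp D * (|C| + D)) * Real.exp ((C + 1) * ∑ k, |g k|))
    (F' := fun s g => n * ∑ σ, tiltedWeight n (u s) (d s) g σ * gaussExponent (u' s) (d' s) g σ)
    Filter.univ_mem (Eventually.of_forall fun s => (hcont s).aestronglyMeasurable) ?_ ?_
    (ae_of_all _ fun g s _ => hbound s g)
    (integrable_finsetSum _ fun σ _ => (integrable_exp_sum_abs_pi_gaussianReal _).const_mul _)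
    (ae_of_all _ fun g s _ => hZn s g)).2
  · convert! hmain using 1
    rw [integral_const_mul]
    congr 1
    have hi1 : ∀ σ k, Integrable (fun g => u' t σ k * (g k * tiltedWeight n (u t) (d t) g σ)) γ :=
      fun σ k => (integrable_coord_mul_tiltedWeight hn _ _ σ k).const_mul _
    have hi2 : ∀ σ, Integrable (fun g => d' t σ * tiltedWeight n (u t) (d t) g σ) γ :=
      fun σ => (integrable_tiltedWeight hn _ _ σ).const_mul _
    have hi3 : ∀ σ k, Integrable (fun g => u' t σ k * (tiltedWeight n (u t) (d t) g σ *
        (u t σ k + (n - 1) * gibbsMean (u t) (d t) g k))) γ := by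
      intro σ k
      refine Integrable.const_mul ?_ _
      simp only [mul_add]
      refine ((integrable_tiltedWeight hn (u t) (d t) σ).mul_const _).add ?_
      simpa only [mul_left_comm] using
        (integrable_tiltedWeight_mul_gibbsMean hn (u t) (d t) σ k).const_mul (n - 1)
    have e1 : ∀ g, ∑ σ, tiltedWeight n (u t) (d t) g σ * gaussExponent (u' t) (d' t) g σ =
        ∑ σ, (∑ k, u' t σ k * (g k * tiltedWeight n (u t) (d t) g σ) +
          d' t σ * tiltedWeight n (u t) (d t) g σ) := by
      intro g
      refine Finset.sum_congr rfl fun σ _ => ?_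
      rw [gaussExponent, mul_add, Finset.mul_sum]
      congr 1
      · exact Finset.sum_congr rfl fun k _ => by ring
      · ring
    have e2 : ∀ g, ∑ σ, tiltedWeight n (u t) (d t) g σ *
        (∑ k, u' t σ k * (u t σ k + (n - 1) * gibbsMean (u t) (d t) g k) + d' t σ) =
        ∑ σ, (∑ k, u' t σ k * (tiltedWeight n (u t) (d t) g σ *
          (u t σ k + (n - 1) * gibbsMean (u t) (d t) g k)) +
          d' t σ * tiltedWeight n (u t) (d t) g σ) := by
      intro g
      refine Finset.sum_congr rfl fun σ _ => ?_
      rw [mul_add, Finset.mul_sum]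
      congr 1
      · exact Finset.sum_congr rfl fun k _ => by ring
      · ring
    simp only [e1, e2]
    rw [integral_finsetSum, integral_finsetSum]
    rotate_left
    · exact fun σ _ => (integrable_finsetSum _ fun k _ => hi1 σ k).add (hi2 σ)
    · exact fun σ _ => (integrable_finsetSum _ fun k _ => hi3 σ k).add (hi2 σ)
    refine Finset.sum_congr rfl fun σ _ => ?_
    rw [integral_add (integrable_finsetSum _ fun k _ => hi3 σ k) (hi2 σ),
      integral_add (integrable_finsetSum _ fun k _ => hi1 σ k) (hi2 σ),
      integral_finsetSum _ fun k _ => hi3 σ k, integral_finsetSum _ fun k _ => hi1 σ k]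
    congr 1
    refine Finset.sum_congr rfl fun k _ => ?_
    rw [integral_const_mul, integral_const_mul, integral_coord_mul_tiltedWeight hn]
  · simp only [← sum_tiltedWeight]
    exact integrable_finsetSum _ fun σ _ => integrable_tiltedWeight hn _ _ σ
  · refine Continuous.aestronglyMeasurable (continuous_const.mul (continuous_finsetSum _ fun σ _ =>
      (continuous_tiltedWeight n _ _ σ).mul (continuous_gaussExponent _ _ σ)))

/-- A comparison inequality of Kahane type for `E[Z^n]`: up to the deterministic correction `m`,
the exponent with the larger covariance has the smaller moment of order `n ∈ (0, 1]`. -/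
theorem integral_gaussPartition_rpow_le [Nonempty S] {n : ℝ} (hn : n ∈ Set.Ioc (0 : ℝ) 1)
    {a b : S → κ → ℝ} (hab : ∀ σ τ k, a σ k * b τ k = 0) (c : S → ℝ) {m : ℝ}
    (hcov : ∀ σ τ, ∑ k, b σ k * b τ k ≤ ∑ k, a σ k * a τ k + m) :
    ∫ g, gaussPartition a (fun σ => c σ - (∑ k, a σ k ^ 2) / 2 - (1 - n) * m / 2) g ^ n
        ∂(Measure.pi fun _ : κ => gaussianReal 0 1) ≤
      ∫ g, gaussPartition b (fun σ => c σ - (∑ k, b σ k ^ 2) / 2) g ^ n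
        ∂(Measure.pi fun _ : κ => gaussianReal 0 1) := by
  set γ := Measure.pi fun _ : κ => gaussianReal 0 1 with hγ
  let u : ℝ → S → κ → ℝ := fun t σ k => Real.sin t * a σ k + Real.cos t * b σ k
  let u' : ℝ → S → κ → ℝ := fun t σ k => Real.cos t * a σ k - Real.sin t * b σ k
  let A : S → ℝ := fun σ => (∑ k, a σ k ^ 2) / 2 + (1 - n) * m / 2
  let B : S → ℝ := fun σ => (∑ k, b σ k ^ 2) / 2
  let d : ℝ → S → ℝ := fun t σ => c σ - (Real.sin t ^ 2 * A σ + Real.cos t ^ 2 * B σ)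
  let d' : ℝ → S → ℝ := fun t σ => -(2 * (Real.sin t * Real.cos t) * (A σ - B σ))
  obtain ⟨C₁, hC₁, ha, hA⟩ := exists_abs_le a A
  obtain ⟨C₂, hC₂, hb, hB⟩ := exists_abs_le b B
  obtain ⟨C₃, hC₃, -, hc⟩ := exists_abs_le a c
  have hs := Real.abs_sin_le_one
  have hco := Real.abs_cos_le_one
  have hderiv := hasDerivAt_integral_gaussPartition_rpow (κ := κ) hn (u := u) (u' := u') (d := d)
    (d' := d') (C := C₁ + C₂) (D := C₃ + 2 * (C₁ + C₂)) ?_ ?_ ?_ ?_ ?_ ?_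
  · have hanti : AntitoneOn (fun t => ∫ g, gaussPartition (u t) (d t) g ^ n ∂γ)
        (Set.Icc 0 (Real.pi / 2)) := by
      refine antitoneOn_of_deriv_nonpos (convex_Icc _ _)
        (fun t _ => (hderiv t).continuousAt.continuousWithinAt)
        (fun t _ => (hderiv t).differentiableAt.differentiableWithinAt) fun t ht => ?_
      rw [interior_Icc] at ht
      rw [(hderiv t).deriv]
      have hsc : 0 ≤ Real.sin t * Real.cos t :=
        mul_nonneg (Real.sin_nonneg_of_nonneg_of_le_pi ht.1.le (by linarith [ht.2, Real.pi_pos]))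
          (Real.cos_nonneg_of_neg_pi_div_two_le_of_le (by linarith [ht.1, Real.pi_pos]) ht.2.le)
      refine mul_nonpos_of_nonneg_of_nonpos hn.1.le (integral_nonpos fun g => ?_)
      have hZ := gaussPartition_pos (u t) (d t) g
      have hK : ∀ σ τ, ∑ k, u' t σ k * u t τ k = Real.sin t * Real.cos t *
          (∑ k, a σ k * a τ k - ∑ k, b σ k * b τ k) := by
        intro σ τ
        rw [← Finset.sum_sub_distrib, Finset.mul_sum]
        refine Finset.sum_congr rfl fun k _ => ?_
        have h1 := hab σ τ k
        have h2 := hab τ σ k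
        simp only [u, u']
        linear_combination Real.cos t ^ 2 * h1 - Real.sin t ^ 2 * h2
      have hterm : ∀ σ, ∑ k, u' t σ k * (u t σ k + (n - 1) * gibbsMean (u t) (d t) g k) + d' t σ =
          -((1 - n) * ((gaussPartition (u t) (d t) g)⁻¹ * (Real.sin t * Real.cos t) *
            ∑ τ, Real.exp (gaussExponent (u t) (d t) g τ) *
              (∑ k, a σ k * a τ k + m - ∑ k, b σ k * b τ k))) := by
        intro σ
        have h1 : ∑ k, u' t σ k * gibbsMean (u t) (d t) g k =
            (gaussPartition (u t) (d t) g)⁻¹ * ∑ τ, Real.exp (gaussExponent (u t) (d t) g τ) *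
              ∑ k, u' t σ k * u t τ k := by
          simp only [gibbsMean, Finset.mul_sum]
          rw [Finset.sum_comm]
          exact Finset.sum_congr rfl fun τ _ => Finset.sum_congr rfl fun k _ => by ring
        have h2 : ∑ τ, Real.exp (gaussExponent (u t) (d t) g τ) *
              (∑ k, a σ k * a τ k + m - ∑ k, b σ k * b τ k) =
            ∑ τ, Real.exp (gaussExponent (u t) (d t) g τ) *
              (∑ k, a σ k * a τ k - ∑ k, b σ k * b τ k) + m * gaussPartition (u t) (d t) g := by
          rw [gaussPartition, Finset.mul_sum, ← Finset.sum_add_distrib]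
          exact Finset.sum_congr rfl fun τ _ => by ring
        have h3 : ∑ τ, Real.exp (gaussExponent (u t) (d t) g τ) * ∑ k, u' t σ k * u t τ k =
            Real.sin t * Real.cos t * ∑ τ, Real.exp (gaussExponent (u t) (d t) g τ) *
              (∑ k, a σ k * a τ k - ∑ k, b σ k * b τ k) := by
          rw [Finset.mul_sum]
          exact Finset.sum_congr rfl fun τ _ => by rw [hK]; ring
        have h4 : ∑ k, u' t σ k * (u t σ k + (n - 1) * gibbsMean (u t) (d t) g k) =
            ∑ k, u' t σ k * u t σ k + (n - 1) * ∑ k, u' t σ k * gibbsMean (u t) (d t) g k := by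
          rw [Finset.mul_sum, ← Finset.sum_add_distrib]
          exact Finset.sum_congr rfl fun k _ => by ring
        rw [h4, h1, h3, h2, hK]
        simp only [d', A, B, pow_two]
        field_simp
        ring
      refine Finset.sum_nonpos fun σ _ => ?_
      rw [hterm]
      refine mul_nonpos_of_nonneg_of_nonpos (tiltedWeight_nonneg _ _ _ _ _)
        (neg_nonpos.2 (mul_nonneg (by linarith [hn.2]) (mul_nonneg (by positivity)
          (Finset.sum_nonneg fun τ _ => mul_nonneg (Real.exp_pos _).le ?_))))
      linarith [hcov σ τ]
    have hle := hanti (Set.left_mem_Icc.2 (by positivity)) (Set.right_mem_Icc.2 (by positivity))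
      (by positivity : (0 : ℝ) ≤ Real.pi / 2)
    simpa [u, d, A, B, sub_sub] using hle
  · intro t σ k
    simpa [u, u', sub_eq_add_neg] using
      ((Real.hasDerivAt_sin t).mul_const (a σ k)).fun_add ((Real.hasDerivAt_cos t).mul_const (b σ k))
  · intro t σ
    have h1 := (((Real.hasDerivAt_sin t).fun_pow 2).mul_const (A σ)).add
      (((Real.hasDerivAt_cos t).fun_pow 2).mul_const (B σ))
    convert! h1.const_sub (c σ) using 1
    simp only [d', Nat.cast_ofNat, Nat.add_one_sub_one, pow_one]
    ring
  · intro t σ k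
    refine (abs_add_le _ _).trans (add_le_add ?_ ?_) <;> rw [abs_mul]
    · exact (mul_le_of_le_one_left (abs_nonneg _) (hs t)).trans (ha σ k)
    · exact (mul_le_of_le_one_left (abs_nonneg _) (hco t)).trans (hb σ k)
  · intro t σ k
    refine (abs_sub _ _).trans (add_le_add ?_ ?_) <;> rw [abs_mul]
    · exact (mul_le_of_le_one_left (abs_nonneg _) (hco t)).trans (ha σ k)
    · exact (mul_le_of_le_one_left (abs_nonneg _) (hs t)).trans (hb σ k)
  · intro t σ
    have h1 : |Real.sin t ^ 2 * A σ + Real.cos t ^ 2 * B σ| ≤ C₁ + C₂ := by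
      refine (abs_add_le _ _).trans (add_le_add ?_ ?_) <;> rw [abs_mul, abs_pow]
      · exact (mul_le_of_le_one_left (abs_nonneg _)
          (pow_le_one₀ (abs_nonneg _) (hs t))).trans (hA σ)
      · exact (mul_le_of_le_one_left (abs_nonneg _)
          (pow_le_one₀ (abs_nonneg _) (hco t))).trans (hB σ)
    have h2 := abs_sub (c σ) (Real.sin t ^ 2 * A σ + Real.cos t ^ 2 * B σ)
    have h3 := hc σ
    simp only [d]
    linarith
  · intro t σ
    have h1 : |Real.sin t * Real.cos t| ≤ 1 := by
      rw [abs_mul]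
      exact mul_le_one₀ (hs t) (abs_nonneg _) (hco t)
    have h2 : |A σ - B σ| ≤ C₁ + C₂ := (abs_sub _ _).trans (add_le_add (hA σ) (hB σ))
    have h3 := mul_le_mul h1 h2 (abs_nonneg _) zero_le_one
    simp only [d', abs_neg, abs_mul, abs_two] at h3 ⊢
    linarith

end GaussianPartition

lemma gaussPartition_sub_const {S κ : Type*} [Fintype S] [Fintype κ] (u : S → κ → ℝ) (d : S → ℝ)
    (e : ℝ) (g : κ → ℝ) :
    gaussPartition u (fun σ => d σ - e) g = Real.exp (-e) * gaussPartition u d g := by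
  simp only [gaussPartition, gaussExponent, Finset.mul_sum, ← Real.exp_add]
  exact Finset.sum_congr rfl fun σ _ => by ring_nf

lemma spinVal_sq (b : Bool) : spinVal b ^ 2 = 1 := by
  cases b <;> simp [spinVal]

lemma sum_lt_mul_eq {N : ℕ} (x : Fin N → ℝ) :
    ∑ p : Fin N × Fin N, (if p.1 < p.2 then x p.1 * x p.2 else 0) =
      ((∑ i, x i) ^ 2 - ∑ i, x i ^ 2) / 2 := by
  have hsq : (∑ i, x i) ^ 2 = ∑ p : Fin N × Fin N, x p.1 * x p.2 := by
    rw [pow_two, Finset.sum_mul_sum, Fintype.sum_prod_type]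
  have hdiag : ∑ i, x i ^ 2 =
      ∑ p : Fin N × Fin N, (if p.1 = p.2 then x p.1 * x p.2 else 0) := by
    rw [Fintype.sum_prod_type]
    simp [pow_two]
  have hswap : ∑ p : Fin N × Fin N, (if p.2 < p.1 then x p.1 * x p.2 else 0) =
      ∑ p : Fin N × Fin N, (if p.1 < p.2 then x p.1 * x p.2 else 0) := by
    refine Fintype.sum_equiv (Equiv.prodComm _ _) _ _ fun p => ?_
    simp [mul_comm]
  have hsplit : ∑ p : Fin N × Fin N, x p.1 * x p.2 =
      ∑ p : Fin N × Fin N, (if p.1 < p.2 then x p.1 * x p.2 else 0) +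
      ∑ p : Fin N × Fin N, (if p.2 < p.1 then x p.1 * x p.2 else 0) +
      ∑ p : Fin N × Fin N, (if p.1 = p.2 then x p.1 * x p.2 else 0) := by
    rw [← Finset.sum_add_distrib, ← Finset.sum_add_distrib]
    refine Finset.sum_congr rfl fun p _ => ?_
    rcases lt_trichotomy p.1 p.2 with h | h | h
    · simp [h, h.ne, h.not_gt]
    · simp [h]
    · simp [h, h.ne', h.not_gt]
  rw [hsq, hdiag, hsplit, hswap]
  ring

/-- Coefficients of the SK interaction `β N^{-1/2} ∑_{i<j} J_{ij} σ_i σ_j`. -/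
def skCoeff (N : ℕ) (β : ℝ) (σ : Fin N → Bool) (p : Fin N × Fin N) : ℝ :=
  if p.1 < p.2 then β * (1 / Real.sqrt N) * (spinVal (σ p.1) * spinVal (σ p.2)) else 0

/-- Coefficients of the random external field `β √q ∑_i z_i σ_i`, with `z_i` stored on the
diagonal. -/
def fieldCoeff (N : ℕ) (β q : ℝ) (σ : Fin N → Bool) (p : Fin N × Fin N) : ℝ :=
  if p.1 = p.2 then β * Real.sqrt q * spinVal (σ p.1) else 0

lemma skCoeff_mul_fieldCoeff (N : ℕ) (β q : ℝ) (σ τ : Fin N → Bool) (p : Fin N × Fin N) :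
    skCoeff N β σ p * fieldCoeff N β q τ p = 0 := by
  unfold skCoeff fieldCoeff
  by_cases h : p.1 < p.2
  · simp [h.ne]
  · simp [h]

lemma sum_skCoeff_mul {N : ℕ} (hN : 1 ≤ N) (β : ℝ) (σ τ : Fin N → Bool) :
    ∑ p, skCoeff N β σ p * skCoeff N β τ p =
      β ^ 2 / (2 * N) * ((∑ i, spinVal (σ i) * spinVal (τ i)) ^ 2 - N) := by
  have hN0 : (0 : ℝ) < N := by exact_mod_cast hN
  have h1 := sum_lt_mul_eq fun i => spinVal (σ i) * spinVal (τ i)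
  have h2 : ∑ i, (spinVal (σ i) * spinVal (τ i)) ^ 2 = N := by
    simp [mul_pow, spinVal_sq]
  have h3 : ∀ p, skCoeff N β σ p * skCoeff N β τ p = β ^ 2 / N *
      (if p.1 < p.2 then
        spinVal (σ p.1) * spinVal (τ p.1) * (spinVal (σ p.2) * spinVal (τ p.2)) else 0) := by
    intro p
    have hs : (1 / Real.sqrt N) ^ 2 = 1 / N := by rw [div_pow, Real.sq_sqrt hN0.le, one_pow]
    unfold skCoeff
    split_ifs
    · linear_combination β ^ 2 * (spinVal (σ p.1) * spinVal (τ p.1) *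
        (spinVal (σ p.2) * spinVal (τ p.2))) * hs
    · simp
  simp only [h3, ← Finset.mul_sum]
  rw [h1, h2]
  field_simp

lemma sum_fieldCoeff_mul (N : ℕ) (β : ℝ) {q : ℝ} (hq : 0 ≤ q) (σ τ : Fin N → Bool) :
    ∑ p, fieldCoeff N β q σ p * fieldCoeff N β q τ p =
      β ^ 2 * q * ∑ i, spinVal (σ i) * spinVal (τ i) := by
  rw [Fintype.sum_prod_type, Finset.mul_sum]
  refine Finset.sum_congr rfl fun i _ => ?_
  rw [Finset.sum_eq_single i]
  · have hs := Real.sq_sqrt hq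
    simp only [fieldCoeff, if_true]
    linear_combination β ^ 2 * spinVal (σ i) * spinVal (τ i) * hs
  · intro j _ hj
    simp [fieldCoeff, hj.symm]
  · simp

lemma gaussPartition_skCoeff (N : ℕ) (β h : ℝ) (J : Fin N × Fin N → ℝ) :
    gaussPartition (skCoeff N β) (fun σ => β * h * ∑ i, spinVal (σ i)) J = skZ N β h J := by
  simp only [gaussPartition, gaussExponent, skZ, skH]
  refine Finset.sum_congr rfl fun σ _ => ?_
  congr 1
  rw [Finset.sum_filter]
  have h1 : ∑ p, skCoeff N β σ p * J p = β * (1 / Real.sqrt N) *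
      ∑ p : Fin N × Fin N, (if p.1 < p.2 then
        J p * spinVal (σ p.1) * spinVal (σ p.2) else 0) := by
    rw [Finset.mul_sum]
    refine Finset.sum_congr rfl fun p _ => ?_
    unfold skCoeff
    split_ifs
    · ring
    · simp
  rw [h1]
  ring

lemma gaussPartition_fieldCoeff (N : ℕ) (β q h : ℝ) (g : Fin N × Fin N → ℝ) :
    gaussPartition (fieldCoeff N β q) (fun σ => β * h * ∑ i, spinVal (σ i)) g =
      ∏ i, (2 * Real.cosh (β * (Real.sqrt q * g (i, i) + h))) := by
  have h1 : ∀ σ : Fin N → Bool, gaussExponent (fieldCoeff N β q)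
      (fun σ => β * h * ∑ i, spinVal (σ i)) g σ =
        ∑ i, spinVal (σ i) * (β * (Real.sqrt q * g (i, i) + h)) := by
    intro σ
    rw [gaussExponent, Fintype.sum_prod_type, Finset.mul_sum, ← Finset.sum_add_distrib]
    refine Finset.sum_congr rfl fun i _ => ?_
    rw [Finset.sum_eq_single i]
    · simp only [fieldCoeff, if_true]
      ring
    · intro j _ hj
      simp [fieldCoeff, hj.symm]
    · simp
  have h2 : ∀ y : ℝ, 2 * Real.cosh y = ∑ b : Bool, Real.exp (spinVal b * y) := by
    intro y
    rw [Real.cosh_eq]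
    simp [spinVal]
    ring
  simp only [gaussPartition, h1, h2, Real.exp_sum]
  rw [Finset.prod_univ_sum, Fintype.piFinset_univ]

lemma integral_prod_diag {N : ℕ} (f : ℝ → ℝ) :
    ∫ g : Fin N × Fin N → ℝ, ∏ i, f (g (i, i)) ∂(Measure.pi fun _ => gaussianReal 0 1) =
      (∫ z, f z ∂gaussianReal 0 1) ^ N := by
  have h1 : ∀ F : Fin N × Fin N → ℝ, ∏ p, (if p.1 = p.2 then F p else 1) = ∏ i, F (i, i) := by
    intro F
    rw [Fintype.prod_prod_type]
    simp
  have h2 := integral_fintype_prod_eq_prod (μ := fun _ : Fin N × Fin N => gaussianReal 0 1)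
    (fun p z => if p.1 = p.2 then f z else 1)
  have h3 : ∀ p : Fin N × Fin N, ∫ z, (if p.1 = p.2 then f z else 1) ∂gaussianReal 0 1 =
      if p.1 = p.2 then ∫ z, f z ∂gaussianReal 0 1 else 1 := by
    intro p
    split_ifs <;> simp
  simpa [h3, h1 fun _ => _, fun g : Fin N × Fin N → ℝ => h1 fun p => f (g p)] using h2

lemma integral_gaussPartition_rpow_pos {S κ : Type*} [Fintype S] [Fintype κ] [Nonempty S] {n : ℝ}
    (hn : n ∈ Set.Ioc (0 : ℝ) 1) (u : S → κ → ℝ) (d : S → ℝ) :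
    0 < ∫ g, gaussPartition u d g ^ n ∂(Measure.pi fun _ : κ => gaussianReal 0 1) := by
  have hi : Integrable (fun g => gaussPartition u d g ^ n)
      (Measure.pi fun _ : κ => gaussianReal 0 1) := by
    simp only [← sum_tiltedWeight]
    exact integrable_finsetSum _ fun σ _ => integrable_tiltedWeight hn u d σ
  simp only [Real.rpow_def_of_pos (gaussPartition_pos u d _)] at hi ⊢
  exact integral_exp_pos hi

/-- The replica symmetric bound before taking logarithms. -/
lemma exp_mul_integral_skZ_rpow_le {N : ℕ} (hN : 1 ≤ N) {n q : ℝ} (β h : ℝ)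
    (hn : n ∈ Set.Ioc (0 : ℝ) 1) (hq : 0 ≤ q) :
    Real.exp (-(β ^ 2 * (N - 1) / 4 + (1 - n) * (β ^ 2 * (N * q ^ 2 + 1) / 2) / 2)) ^ n *
        ∫ J, skZ N β h J ^ n ∂skMuJ N ≤
      Real.exp (-(β ^ 2 * q * N / 2)) ^ n *
        (2 ^ n * ∫ z, Real.cosh (β * (Real.sqrt q * z + h)) ^ n ∂gaussianReal 0 1) ^ N := by
  have hN0 : (0 : ℝ) < N := by exact_mod_cast hN
  have hdiag : ∀ σ : Fin N → Bool, ∑ i, spinVal (σ i) * spinVal (σ i) = N := by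
    intro σ
    simp [← pow_two, spinVal_sq]
  have hA : ∀ σ : Fin N → Bool, ∑ p, skCoeff N β σ p ^ 2 = β ^ 2 * (N - 1) / 2 := by
    intro σ
    simp only [pow_two (skCoeff N β σ _)]
    rw [sum_skCoeff_mul hN, hdiag]
    field_simp
  have hB : ∀ σ : Fin N → Bool, ∑ p, fieldCoeff N β q σ p ^ 2 = β ^ 2 * q * N := by
    intro σ
    simp only [pow_two (fieldCoeff N β q σ _)]
    rw [sum_fieldCoeff_mul N β hq, hdiag]
  have hcmp := integral_gaussPartition_rpow_le hn (a := skCoeff N β) (b := fieldCoeff N β q)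
    (skCoeff_mul_fieldCoeff N β q) (fun σ => β * h * ∑ i, spinVal (σ i))
    (m := β ^ 2 * (N * q ^ 2 + 1) / 2) ?_
  · have hcosh : ∀ z, 0 ≤ 2 * Real.cosh (β * (Real.sqrt q * z + h)) := fun z =>
      mul_nonneg zero_le_two (Real.cosh_pos _).le
    have hZ0 : ∀ J, 0 ≤ skZ N β h J := fun J => Finset.sum_nonneg fun _ _ => (Real.exp_pos _).le
    simp only [hA, hB, sub_sub, gaussPartition_sub_const, gaussPartition_skCoeff,
      gaussPartition_fieldCoeff] at hcmp
    simp only [Real.mul_rpow (Real.exp_pos _).le (hZ0 _),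
      Real.mul_rpow (Real.exp_pos _).le (Finset.prod_nonneg fun _ _ => hcosh _),
      ← Real.finsetProd_rpow _ _ fun _ _ => hcosh _,
      Real.mul_rpow zero_le_two (Real.cosh_pos _).le, integral_const_mul] at hcmp
    rw [integral_prod_diag fun z => 2 ^ n * Real.cosh (β * (Real.sqrt q * z + h)) ^ n,
      integral_const_mul] at hcmp
    have e : β ^ 2 * (N - 1) / 2 / 2 = β ^ 2 * ((N : ℝ) - 1) / 4 := by ring
    rw [e] at hcmp
    exact hcmp
  · intro σ τ
    rw [sum_skCoeff_mul hN, sum_fieldCoeff_mul N β hq, ← sub_nonneg]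
    have e : ∀ M : ℝ, β ^ 2 / (2 * N) * (M ^ 2 - N) + β ^ 2 * (N * q ^ 2 + 1) / 2 -
        β ^ 2 * q * M = β ^ 2 / (2 * N) * (M - N * q) ^ 2 := by
      intro M
      field_simp
      ring
    rw [e]
    positivity

/-- the replica symmetric bound
`φ_N(n,β,h) ≤ log 2 + n⁻¹ log ∫ cosh^n(β(√q z + h)) dμ(z) + (β²/4)(1 - 2q - (n-1)q²)`. -/
theorem stmt8 (N : ℕ) (hN : 1 ≤ N) (n q β h : ℝ) (hn : n ∈ Set.Ioc (0:ℝ) 1)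
    (hq : q ∈ Set.Icc (0:ℝ) 1) (hβ : 0 < β) :
    skPhi N n β h ≤
      Real.log 2 +
        (1 / n) * Real.log (∫ z, Real.cosh (β * (Real.sqrt q * z + h)) ^ n
          ∂ gaussianReal 0 1) +
        β ^ 2 / 4 * (1 - 2 * q - (n - 1) * q ^ 2) := by
  have hN0 : (0 : ℝ) < N := by exact_mod_cast hN
  have hn0 := hn.1
  have hmain := exp_mul_integral_skZ_rpow_le hN β h hn hq.1
  have hE : 0 < ∫ J, skZ N β h J ^ n ∂skMuJ N := by
    simpa only [gaussPartition_skCoeff, skMuJ] using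
      integral_gaussPartition_rpow_pos hn (skCoeff N β) fun σ => β * h * ∑ i, spinVal (σ i)
  unfold skPhi
  set E := ∫ J, skZ N β h J ^ n ∂skMuJ N
  set I := ∫ z, Real.cosh (β * (Real.sqrt q * z + h)) ^ n ∂gaussianReal 0 1
  have hI0 : 0 ≤ I := integral_nonneg fun z => Real.rpow_nonneg (Real.cosh_pos _).le _
  have hI : 0 < I := by
    refine hI0.lt_of_ne fun h0 => ?_
    rw [← h0, mul_zero, zero_pow (by omega), mul_zero] at hmain
    exact absurd hmain (not_le.2 (by positivity))
  have hlog := Real.log_le_log (by positivity) hmain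
  rw [Real.log_mul (by positivity) hE.ne', Real.log_mul (by positivity) (by positivity),
    Real.log_pow, Real.log_mul (by positivity) hI.ne', Real.log_rpow (Real.exp_pos _),
    Real.log_rpow (Real.exp_pos _), Real.log_exp, Real.log_exp, Real.log_rpow two_pos] at hlog
  rw [one_div_mul_eq_div, div_le_iff₀ (by positivity)]
  have e : (Real.log 2 + 1 / n * Real.log I + β ^ 2 / 4 * (1 - 2 * q - (n - 1) * q ^ 2)) *
      (N * n) = N * (n * Real.log 2 + Real.log I) +
        N * n * (β ^ 2 / 4 * (1 - 2 * q - (n - 1) * q ^ 2)) := by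
    field_simp
  rw [e]
  have hcorr : 0 ≤ β ^ 2 * n ^ 2 / 4 := by positivity
  linarith
end
end

section
/- Let n ∈ (0,1), β > 0, h ∈ ℝ and q ∈ (0,1). Then the q-derivative of the replica symmetric trial function satisfies ∂_q α(n,β,h,q) = (β²/2)(n−1)( ⟨tanh²θ⟩_n − q ), where ⟨F(θ)⟩_n = ( ∫_ℝ cosh^n θ · F(θ) dμ(z) ) / ( ∫_ℝ cosh^n θ dμ(z) ) with θ = β(√q z + h). In particular ∂_q α(n,β,h,q) = 0 if and only if q = ⟨tanh²θ⟩_n. -/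
open MeasureTheory ProbabilityTheory Real Filter Topology

noncomputable section

/-- Replica symmetric trial function
`α(n,β,h,q) = log 2 + n⁻¹ log ∫ cosh^n(β(√q z + h)) dμ(z) + (β²/4)(1 - 2q - (n-1)q²)`. -/
def rsTrial (n β h q : ℝ) : ℝ :=
  Real.log 2 +
    (1 / n) * Real.log (∫ z, Real.cosh (β * (Real.sqrt q * z + h)) ^ n ∂ gaussianReal 0 1) +
    β ^ 2 / 4 * (1 - 2 * q - (n - 1) * q ^ 2)

/-- The deformed average `⟨tanh²θ⟩_n` with `θ = β(√q z + h)`: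
`(∫ cosh^n θ tanh² θ dμ(z)) / (∫ cosh^n θ dμ(z))`. -/
def tanhSqAvg (n β h q : ℝ) : ℝ :=
  (∫ z, Real.cosh (β * (Real.sqrt q * z + h)) ^ n *
        Real.tanh (β * (Real.sqrt q * z + h)) ^ 2 ∂ gaussianReal 0 1) /
    (∫ z, Real.cosh (β * (Real.sqrt q * z + h)) ^ n ∂ gaussianReal 0 1)

/-- `exp (c |z|)` is integrable for the Gaussian measure. -/
lemma integrable_exp_mul_abs_gaussianReal (c : ℝ) :
    Integrable (fun z : ℝ ↦ Real.exp (c * |z|)) (gaussianReal 0 1) :=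
  integrable_exp_mul_abs (X := fun z : ℝ ↦ z) (integrable_exp_mul_gaussianReal c)
    (integrable_exp_mul_gaussianReal (-c))

lemma integrable_gaussianReal_iff {g : ℝ → ℝ} :
    Integrable g (gaussianReal 0 1) ↔ Integrable (fun z ↦ gaussianPDFReal 0 1 z * g z) := by
  rw [gaussianReal_of_var_ne_zero 0 one_ne_zero,
    integrable_withDensity_iff_integrable_smul' (measurable_gaussianPDF _ _)
      (ae_of_all _ fun _ ↦ gaussianPDF_lt_top)]
  simp

lemma hasDerivAt_gaussianPDFReal (z : ℝ) :
    HasDerivAt (gaussianPDFReal 0 1) (-(z * gaussianPDFReal 0 1 z)) z := by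
  rw [gaussianPDFReal_def]
  have h : HasDerivAt (fun x : ℝ ↦ -(x - 0) ^ 2 / (2 * ((1 : NNReal) : ℝ))) (-z) z := by
    have := (((hasDerivAt_id z).sub_const 0).pow 2).neg.div_const (2 * ((1 : NNReal) : ℝ))
    exact this.congr_deriv (by simp; ring)
  refine (h.exp.const_mul (√(2 * π * ((1 : NNReal) : ℝ)))⁻¹).congr_deriv ?_
  ring

/-- Gaussian integration by parts. -/
lemma integral_mul_gaussianReal_eq_integral_deriv {g g' : ℝ → ℝ}
    (hg : ∀ z, HasDerivAt g (g' z) z) (hg_int : Integrable g (gaussianReal 0 1))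
    (hg'_int : Integrable g' (gaussianReal 0 1))
    (hzg_int : Integrable (fun z ↦ z * g z) (gaussianReal 0 1)) :
    ∫ z, z * g z ∂gaussianReal 0 1 = ∫ z, g' z ∂gaussianReal 0 1 := by
  rw [integrable_gaussianReal_iff] at hg_int hg'_int hzg_int
  rw [integral_gaussianReal_eq_integral_smul one_ne_zero,
    integral_gaussianReal_eq_integral_smul one_ne_zero]
  have hmul (z : ℝ) : -(z * gaussianPDFReal 0 1 z) * g z =
      -(gaussianPDFReal 0 1 z * (z * g z)) := by ring
  have key := integral_mul_deriv_eq_deriv_mul_of_integrable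
    (u := gaussianPDFReal 0 1) (v := g) (fun z _ ↦ hasDerivAt_gaussianPDFReal z)
    (fun z _ ↦ hg z) hg'_int
    (hzg_int.neg.congr (ae_of_all _ fun z ↦ (hmul z).symm)) hg_int
  simp only [smul_eq_mul]
  rw [key, ← integral_neg]
  exact integral_congr_ae (ae_of_all _ fun z ↦ by simp only [hmul, neg_neg])

/-- The Gaussian heat equation: the derivative in the variance of the Gaussian average of a
function of exponential growth is half the average of its second derivative. -/
lemma hasDerivAt_integral_comp_sqrt_gaussianReal {f f' f'' : ℝ → ℝ}
    (hf : ∀ x, HasDerivAt f (f' x) x) (hf' : ∀ x, HasDerivAt f' (f'' x) x)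
    (hf''_cont : Continuous f'') (hf_le : ∀ x, |f x| ≤ Real.exp |x|)
    (hf'_le : ∀ x, |f' x| ≤ Real.exp |x|) (hf''_le : ∀ x, |f'' x| ≤ Real.exp |x|)
    (β h : ℝ) {q : ℝ} (hq : 0 < q) :
    HasDerivAt (fun q' ↦ ∫ z, f (β * (√q' * z + h)) ∂gaussianReal 0 1)
      (β ^ 2 / 2 * ∫ z, f'' (β * (√q * z + h)) ∂gaussianReal 0 1) q := by
  have hf_cont : Continuous f := continuous_iff_continuousAt.2 fun x ↦ (hf x).continuousAt
  have hf'_cont : Continuous f' := continuous_iff_continuousAt.2 fun x ↦ (hf' x).continuousAt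
  set B : ℝ → ℝ := fun z ↦ Real.exp (|β| * |h|) * Real.exp (|β| * √(q + 1) * |z|) with hB
  have hexp : ∀ r ≤ q + 1, ∀ z, Real.exp |β * (√r * z + h)| ≤ B z := by
    intro r hr z
    simp only [hB]
    rw [← Real.exp_add, Real.exp_le_exp, abs_mul]
    calc |β| * |√r * z + h| ≤ |β| * (√(q + 1) * |z| + |h|) := by
          gcongr
          refine (abs_add_le _ _).trans ?_
          rw [abs_mul, abs_of_nonneg (Real.sqrt_nonneg r)]
          gcongr
      _ = _ := by ring
  have hB_int : Integrable B (gaussianReal 0 1) :=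
    (integrable_exp_mul_abs_gaussianReal _).const_mul _
  have hBz_int : Integrable (fun z ↦ |z| * B z) (gaussianReal 0 1) := by
    refine ((integrable_exp_mul_abs_gaussianReal (1 + |β| * √(q + 1))).const_mul
      (Real.exp (|β| * |h|))).mono' (by fun_prop) (ae_of_all _ fun z ↦ ?_)
    have hz : |z| ≤ Real.exp |z| := by linarith [Real.add_one_le_exp |z|]
    rw [Real.norm_of_nonneg (by positivity), hB]
    calc |z| * (Real.exp (|β| * |h|) * Real.exp (|β| * √(q + 1) * |z|))
        ≤ Real.exp |z| * (Real.exp (|β| * |h|) * Real.exp (|β| * √(q + 1) * |z|)) := by gcongr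
      _ = _ := by rw [add_mul, one_mul, Real.exp_add]; ring
  have hint : ∀ {g : ℝ → ℝ}, Continuous g → (∀ x, |g x| ≤ Real.exp |x|) →
      Integrable (fun z ↦ g (β * (√q * z + h))) (gaussianReal 0 1) := fun hg hg_le ↦
    hB_int.mono' (by fun_prop)
      (ae_of_all _ fun z ↦ (hg_le _).trans (hexp q (by linarith) z))
  have hzint : Integrable (fun z ↦ z * f' (β * (√q * z + h))) (gaussianReal 0 1) :=
    hBz_int.mono' (by fun_prop) (ae_of_all _ fun z ↦ by
      rw [Real.norm_eq_abs, abs_mul]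
      exact mul_le_mul_of_nonneg_left ((hf'_le _).trans (hexp q (by linarith) z)) (abs_nonneg z))
  have hs : 0 < √q := Real.sqrt_pos.2 hq
  have hparts : ∫ z, z * f' (β * (√q * z + h)) ∂gaussianReal 0 1 =
      ∫ z, f'' (β * (√q * z + h)) * (β * √q) ∂gaussianReal 0 1 := by
    refine integral_mul_gaussianReal_eq_integral_deriv (fun z ↦ ?_) (hint hf'_cont hf'_le)
      ((hint hf''_cont hf''_le).mul_const _) hzint
    have hθ : HasDerivAt (fun z ↦ β * (√q * z + h)) (β * √q) z := by
      simpa using (((hasDerivAt_id z).const_mul √q).add_const h).const_mul β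
    exact (hf' _).comp z hθ
  have hderiv := (hasDerivAt_integral_of_dominated_loc_of_deriv_le (μ := gaussianReal 0 1)
    (F := fun r z ↦ f (β * (√r * z + h))) (x₀ := q) (s := Set.Ioo (q / 2) (q + 1))
    (F' := fun r z ↦ f' (β * (√r * z + h)) * (β * (1 / (2 * √r) * z)))
    (bound := fun z ↦ |β| * (1 / (2 * √(q / 2))) * (|z| * B z))
    (Ioo_mem_nhds (by linarith) (by linarith))
    (Eventually.of_forall fun r ↦ by fun_prop) (hint hf_cont hf_le)
    (by fun_prop) (ae_of_all _ fun z r hr ↦ ?_) (hBz_int.const_mul _)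
    (ae_of_all _ fun z r hr ↦ ?_)).2
  · refine hderiv.congr_deriv ?_
    have hcongr (z : ℝ) : f' (β * (√q * z + h)) * (β * (1 / (2 * √q) * z)) =
        β / (2 * √q) * (z * f' (β * (√q * z + h))) := by ring
    simp_rw [hcongr]
    rw [integral_const_mul, hparts, integral_mul_const]
    field_simp
  · have hr0 : 0 < √(q / 2) := Real.sqrt_pos.2 (by linarith)
    have hrle : √(q / 2) ≤ √r := Real.sqrt_le_sqrt hr.1.le
    rw [Real.norm_eq_abs, abs_mul, abs_mul, abs_mul,
      abs_of_nonneg (show 0 ≤ 1 / (2 * √r) by positivity)]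
    calc |f' (β * (√r * z + h))| * (|β| * (1 / (2 * √r) * |z|))
        ≤ B z * (|β| * (1 / (2 * √(q / 2)) * |z|)) := by
          gcongr
          exact (hf'_le _).trans (hexp r hr.2.le z)
      _ = _ := by ring
  · have hr0 : r ≠ 0 := by linarith [hr.1]
    have hθ : HasDerivAt (fun r ↦ β * (√r * z + h)) (β * (1 / (2 * √r) * z)) r :=
      (((Real.hasDerivAt_sqrt hr0).mul_const z).add_const h).const_mul β
    exact (hf _).comp r hθ

lemma hasDerivAt_tanh (x : ℝ) : HasDerivAt Real.tanh (1 - Real.tanh x ^ 2) x := by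
  have hc := (Real.cosh_pos x).ne'
  rw [show Real.tanh = fun y ↦ Real.sinh y / Real.cosh y from
    funext Real.tanh_eq_sinh_div_cosh]
  refine ((Real.hasDerivAt_sinh x).div (Real.hasDerivAt_cosh x) hc).congr_deriv ?_
  field_simp

lemma continuous_real_tanh : Continuous Real.tanh :=
  continuous_iff_continuousAt.2 fun x ↦ (hasDerivAt_tanh x).continuousAt

lemma hasDerivAt_cosh_rpow (n x : ℝ) :
    HasDerivAt (fun y ↦ Real.cosh y ^ n) (n * (Real.cosh x ^ n * Real.tanh x)) x := by
  have hc := Real.cosh_pos x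
  refine ((Real.hasDerivAt_cosh x).rpow_const (p := n) (Or.inl hc.ne')).congr_deriv ?_
  rw [Real.rpow_sub_one hc.ne', Real.tanh_eq_sinh_div_cosh]
  ring

lemma hasDerivAt_cosh_rpow_mul_tanh (n x : ℝ) :
    HasDerivAt (fun y ↦ n * (Real.cosh y ^ n * Real.tanh y))
      (n * (Real.cosh x ^ n * (1 + (n - 1) * Real.tanh x ^ 2))) x := by
  refine (((hasDerivAt_cosh_rpow n x).mul (hasDerivAt_tanh x)).const_mul n).congr_deriv ?_
  ring

lemma cosh_rpow_le_exp_abs {n : ℝ} (hn : n ≤ 1) (x : ℝ) :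
    Real.cosh x ^ n ≤ Real.exp |x| := by
  calc Real.cosh x ^ n ≤ Real.cosh x ^ (1 : ℝ) :=
        Real.rpow_le_rpow_of_exponent_le (Real.one_le_cosh x) hn
    _ = Real.cosh |x| := by rw [Real.rpow_one, Real.cosh_abs]
    _ ≤ Real.exp |x| := by
        have := Real.cosh_add_sinh |x|
        have := Real.sinh_nonneg_iff.2 (abs_nonneg x)
        linarith

/-- Integrability of a continuous function of exponential growth of a Gaussian variable. -/
lemma integrable_comp_affine_gaussianReal {g : ℝ → ℝ} (hg : Continuous g)
    (hg_le : ∀ x, |g x| ≤ Real.exp |x|) (a b : ℝ) :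
    Integrable (fun z ↦ g (a * z + b)) (gaussianReal 0 1) := by
  refine ((integrable_exp_mul_abs_gaussianReal |a|).const_mul (Real.exp |b|)).mono'
    (by fun_prop) (ae_of_all _ fun z ↦ (hg_le _).trans ?_)
  rw [← Real.exp_add, Real.exp_le_exp, ← abs_mul, add_comm]
  exact abs_add_le _ _

/-- `∂_q α(n,β,h,q) = (β²/2)(n-1)(⟨tanh²θ⟩_n - q)`; in particular the
derivative vanishes iff `q = ⟨tanh²θ⟩_n`. -/
theorem stmt12 (n β h q : ℝ) (hn : n ∈ Set.Ioo (0:ℝ) 1) (hβ : 0 < β)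
    (hq : q ∈ Set.Ioo (0:ℝ) 1) :
    HasDerivAt (fun q' => rsTrial n β h q')
      (β ^ 2 / 2 * (n - 1) * (tanhSqAvg n β h q - q)) q ∧
    (β ^ 2 / 2 * (n - 1) * (tanhSqAvg n β h q - q) = 0 ↔ q = tanhSqAvg n β h q) := by
  obtain ⟨hn0, hn1⟩ := hn
  obtain ⟨hq0, hq1⟩ := hq
  have hc_cont : Continuous fun x ↦ Real.cosh x ^ n :=
    Real.continuous_cosh.rpow_const fun x ↦ Or.inl (Real.cosh_pos x).ne'
  have ht_cont := continuous_real_tanh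
  have hbound : ∀ c : ℝ, |c| ≤ 1 → ∀ x, |Real.cosh x ^ n * c| ≤ Real.exp |x| := by
    intro c hc x
    have hpos : 0 < Real.cosh x ^ n := Real.rpow_pos_of_pos (Real.cosh_pos x) n
    rw [abs_mul, abs_of_pos hpos]
    exact (mul_le_of_le_one_right hpos.le hc).trans (cosh_rpow_le_exp_abs hn1.le x)
  have hmul_int : ∀ g : ℝ → ℝ, Continuous g → (∀ x, |g x| ≤ 1) →
      Integrable (fun z ↦ Real.cosh (β * (√q * z + h)) ^ n * g (β * (√q * z + h)))
        (gaussianReal 0 1) := by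
    intro g hg hg_le
    have := integrable_comp_affine_gaussianReal (g := fun x ↦ Real.cosh x ^ n * g x)
      (hc_cont.mul hg) (fun x ↦ hbound _ (hg_le x) x) (β * √q) (β * h)
    simpa only [mul_add, mul_assoc] using this
  have hc_int : Integrable (fun z ↦ Real.cosh (β * (√q * z + h)) ^ n) (gaussianReal 0 1) := by
    simpa using hmul_int (fun _ ↦ 1) continuous_const (by simp)
  have hct_int : Integrable (fun z ↦ Real.cosh (β * (√q * z + h)) ^ n *
      Real.tanh (β * (√q * z + h)) ^ 2) (gaussianReal 0 1) :=
    hmul_int (fun x ↦ Real.tanh x ^ 2) (by fun_prop) fun x ↦ by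
      rw [abs_of_nonneg (sq_nonneg _)]; exact (Real.tanh_sq_lt_one x).le
  have hI : 0 < ∫ z, Real.cosh (β * (√q * z + h)) ^ n ∂gaussianReal 0 1 := by
    have : ∫ _, (1 : ℝ) ∂gaussianReal 0 1 ≤
        ∫ z, Real.cosh (β * (√q * z + h)) ^ n ∂gaussianReal 0 1 :=
      integral_mono (integrable_const _) hc_int fun z ↦
        Real.one_le_rpow (Real.one_le_cosh _) hn0.le
    simp only [integral_const, probReal_univ, smul_eq_mul, mul_one] at this
    linarith
  have hheat := hasDerivAt_integral_comp_sqrt_gaussianReal (hasDerivAt_cosh_rpow n)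
    (hasDerivAt_cosh_rpow_mul_tanh n) (by fun_prop)
    (fun x ↦ by simpa using hbound 1 (by simp) x)
    (fun x ↦ by
      rw [mul_left_comm]
      refine hbound _ ?_ x
      rw [abs_mul, abs_of_pos hn0]
      exact mul_le_one₀ hn1.le (abs_nonneg _) (Real.abs_tanh_lt_one x).le)
    (fun x ↦ by
      rw [mul_left_comm]
      refine hbound _ ?_ x
      have h1 := (Real.tanh_sq_lt_one x).le
      have h2 := sq_nonneg (Real.tanh x)
      have h3 : 0 ≤ 1 + (n - 1) * Real.tanh x ^ 2 := by nlinarith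
      rw [abs_of_nonneg (mul_nonneg hn0.le h3)]
      exact mul_le_one₀ hn1.le h3 (by nlinarith))
    β h hq0
  refine ⟨?_, ?_⟩
  · have hpoly : HasDerivAt (fun r : ℝ ↦ β ^ 2 / 4 * (1 - 2 * r - (n - 1) * r ^ 2))
        (β ^ 2 / 4 * (-2 - (n - 1) * (2 * q))) q := by
      have := ((((hasDerivAt_id q).const_mul 2).const_sub 1).sub
        (((hasDerivAt_id q).pow 2).const_mul (n - 1))).const_mul (β ^ 2 / 4)
      exact this.congr_deriv (by simp)
    have htot := (((hheat.log hI.ne').const_mul (1 / n)).const_add (Real.log 2)).add hpoly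
    refine htot.congr_deriv ?_
    have hsplit (z : ℝ) : n * (Real.cosh (β * (√q * z + h)) ^ n *
        (1 + (n - 1) * Real.tanh (β * (√q * z + h)) ^ 2)) =
        n * (Real.cosh (β * (√q * z + h)) ^ n + (n - 1) *
          (Real.cosh (β * (√q * z + h)) ^ n * Real.tanh (β * (√q * z + h)) ^ 2)) := by ring
    simp_rw [hsplit]
    rw [integral_const_mul, integral_add hc_int (hct_int.const_mul _), integral_const_mul,
      tanhSqAvg]
    have hI' := hI.ne'
    have hn' := hn0.ne'
    generalize (∫ z, Real.cosh (β * (√q * z + h)) ^ n ∂gaussianReal 0 1) = I at *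
    field_simp
    ring
  · have hcoef : β ^ 2 / 2 * (n - 1) ≠ 0 :=
      mul_ne_zero (by positivity) (by linarith)
    rw [mul_eq_zero, or_iff_right hcoef, sub_eq_zero, eq_comm]
end
end
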